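/- Let L be a lattice with a least element ⊥, and let S ⊆ L. Suppose S admits a countable decomposition S = ⋃_{n≥2} F_n such that for every n, every subset of F_n of cardinality n contains two distinct elements f, g with f ⊓ g ≠ ⊥. Then for every uncountable family T ⊆ S there exists an uncountable subfamily G ⊆ T such that f ⊓ g ≠ ⊥ for all f, g ∈ G. (The σ-bounded chain condition implies Knaster's condition K₂.) -/

import Mathlib

/-- If every `n`-element subset of an uncountable set `A` contains two distinct elements related by
the symmetric relation `r`, then `A` has an uncountable subset which is pairwise related. -/
theorem Set.exists_uncountable_pairwise {α : Type*} {r : α → α → Prop} [Std.Symm r] (n : ℕ)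
    {A : Set α} (hA : ¬A.Countable)
    (h : ∀ s : Finset α, (s : Set α) ⊆ A → s.card = n → ∃ f ∈ s, ∃ g ∈ s, f ≠ g ∧ r f g) :
    ∃ G ⊆ A, ¬G.Countable ∧ G.Pairwise r := by
  classical
  induction n generalizing A with
  | zero => simpa using h ∅ (by simp) rfl
  | succ n ih =>
    by_cases hc : ∃ a ∈ A, ¬{b ∈ A | b ≠ a ∧ ¬r a b}.Countable
    · obtain ⟨a, ha, hB⟩ := hc
      obtain ⟨G, hG, hG'⟩ := ih hB (by
        intro s hs hn
        have has : a ∉ s := fun h' => (hs h').2.1 rfl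
        obtain ⟨f, hf, g, hg, hfg, hrfg⟩ := h (insert a s)
          (by
            rw [Finset.coe_insert, Set.insert_subset_iff]
            exact ⟨ha, fun x hx => (hs hx).1⟩)
          (by rw [Finset.card_insert_of_notMem has, hn])
        rcases Finset.mem_insert.1 hf with rfl | hfs
        · exact absurd hrfg (hs ((Finset.mem_insert.1 hg).resolve_left hfg.symm)).2.2
        · rcases Finset.mem_insert.1 hg with rfl | hg
          · exact absurd (symm_of r hrfg) (hs hfs).2.2
          · exact ⟨f, hfs, g, hg, hfg, hrfg⟩)
      exact ⟨G, hG.trans fun x hx => hx.1, hG'⟩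
    · push Not at hc
      obtain ⟨M, hM⟩ := zorn_subset {M : Set α | M ⊆ A ∧ M.Pairwise r} fun c hcS hch =>
        ⟨⋃₀ c, ⟨Set.sUnion_subset fun s hs => (hcS hs).1,
          (Set.pairwise_sUnion hch.directedOn).2 fun s hs => (hcS hs).2⟩,
          fun s hs => Set.subset_sUnion_of_mem hs⟩
      refine ⟨M, hM.prop.1, fun hMc => hA ?_, hM.prop.2⟩
      refine (hMc.union (hMc.biUnion fun a ha => hc a (hM.prop.1 ha))).mono fun x hx => ?_
      by_contra hx'
      simp only [Set.mem_union, Set.mem_iUnion, Set.mem_ofPred_eq, not_or, not_exists, not_and,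
        not_not] at hx'
      obtain ⟨hxM, hxr⟩ := hx'
      refine hxM (hM.le_of_ge (y := insert x M) ⟨Set.insert_subset hx hM.prop.1, ?_⟩
        (Set.subset_insert x M) (Set.mem_insert x M))
      refine Set.pairwise_insert_of_symm.2 ⟨hM.prop.2, fun b hb hxb => ?_⟩
      exact symm_of r (hxr b hb hx hxb)


/-- In a lattice with bottom element, if `S = ⋃_{n ≥ 2} F n` where any `n`
elements of `F n` contain two distinct elements with infimum `≠ ⊥` (σ-bounded
chain condition), then every uncountable `T ⊆ S` contains an uncountable
subfamily whose members are pairwise non-disjoint (Knaster's condition K₂). -/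
theorem stmt_5 (L : Type*) [Lattice L] [OrderBot L] (S : Set L)
    (F : ℕ → Set L) (hS : S = ⋃ n ∈ Set.Ici 2, F n)
    (hF : ∀ n ∈ Set.Ici 2, ∀ G : Set L, G ⊆ F n → G.Finite → G.ncard = n →
      ∃ f ∈ G, ∃ g ∈ G, f ≠ g ∧ f ⊓ g ≠ ⊥) :
    ∀ T ⊆ S, ¬T.Countable →
      ∃ G ⊆ T, ¬G.Countable ∧ ∀ f ∈ G, ∀ g ∈ G, f ⊓ g ≠ ⊥ := by
  intro T hT hTc
  have hT' : ¬(T \ {⊥}).Countable := fun hc =>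
    hTc ((hc.union (Set.countable_singleton ⊥)).mono (by simp))
  obtain ⟨n, hn, hTn⟩ : ∃ n ∈ Set.Ici 2, ¬((T \ {⊥}) ∩ F n).Countable := by
    by_contra! hc
    refine hT' ((Set.Countable.biUnion (Set.to_countable (Set.Ici 2)) hc).mono fun x hx => ?_)
    have hxS := hT hx.1
    rw [hS, Set.mem_iUnion₂] at hxS
    obtain ⟨n, hn, hxn⟩ := hxS
    exact Set.mem_biUnion hn ⟨hx, hxn⟩
  have : Std.Symm fun f g : L => f ⊓ g ≠ ⊥ := ⟨fun f g h => by rwa [inf_comm]⟩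
  obtain ⟨G, hG, hGc, hGp⟩ := Set.exists_uncountable_pairwise (r := fun f g : L => f ⊓ g ≠ ⊥)
    n hTn fun s hs hsn =>
      hF n hn s (fun x hx => (hs hx).2) s.finite_toSet (by rw [Set.ncard_coe_finset, hsn])
  refine ⟨G, fun x hx => (hG hx).1.1, hGc, fun f hf g hg => ?_⟩
  rcases eq_or_ne f g with rfl | hfg
  · rw [inf_idem]
    exact (hG hf).1.2
  · exact hGp hf hg hfg
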